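/- Suppose a Kakeya estimate holds at dimension d ∈ (2,3) with exponent α and constant A₀. Let 0 < ε ≪ 1, let δ > 0 be sufficiently small, let 𝕋 be a sticky collection of δ-tubes with constants (A, C) satisfying |E_δ| ≤ A δ^{−Cε} δ^{3−d}, where E_δ = ⋃_{T∈𝕋} T. Then there exist constants A₁, C₂, c > 0, depending only on d, α, A₀, A, C (with c absolute), such that Σ_{T∈𝕋} |{ x ∈ T : there exists σ with δ ≤ σ ≤ 1 such that |E_δ ∩ B(x, C₂σ)| > A₁ δ^{−√ε} δ^{3−d} σ^d }| ≤ A₁ δ^{c√ε} Σ_{T∈𝕋} |T|. In other words, for most pairs (T, x) with T ∈ 𝕋 and x ∈ T, the bound |E_δ ∩ B(x, C₂σ)| ≤ A₁ δ^{−√ε} δ^{3−d} σ^d holds simultaneously for all scales δ ≤ σ ≤ 1. -/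

import Mathlib

open MeasureTheory Metric Set
open scoped ENNReal NNReal RealInnerProductSpace

noncomputable section

abbrev R3 : Type := EuclideanSpace ℝ (Fin 3)

/-- A tube core: a line segment joining the planes {z = 0} and {z = 1},
with orientation within 1/10 of the vertical. -/
structure Tube where
  p0 : R3
  p1 : R3
  h0 : p0 2 = 0
  h1 : p1 2 = 1
  hx : |(p1 - p0) 0| ≤ 1/10
  hy : |(p1 - p0) 1| ≤ 1/10

/-- The direction of a tube: the difference of its endpoints. -/
def Tube.dir (T : Tube) : R3 := T.p1 - T.p0

/-- The σ-tube associated to a tube core: the σ-neighbourhood of the segment. -/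
def Tube.set (T : Tube) (σ : ℝ) : Set R3 :=
  Metric.thickening σ (segment ℝ T.p0 T.p1)

/-- A direction: a vector (x, y, 1) within 1/10 of the vertical. -/
def IsDirection (v : R3) : Prop := v 2 = 1 ∧ |v 0| ≤ 1/10 ∧ |v 1| ≤ 1/10

/-- Two σ-tubes are equivalent (with constant C): each lies in the C-dilate of the other. -/
def TubeEquiv (C σ : ℝ) (T T' : Tube) : Prop :=
  T.set σ ⊆ T'.set (C * σ) ∧ T'.set σ ⊆ T.set (C * σ)

/-- A collection of σ-tubes is essentially distinct (with constant C): each of its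
tubes is equivalent to at most C of the others. -/
def EssDistinct (C σ : ℝ) (𝕋 : Set Tube) : Prop :=
  𝕋.Finite ∧ ∀ T ∈ 𝕋, (({T' ∈ 𝕋 | T' ≠ T ∧ TubeEquiv C σ T T'}.ncard : ℝ)) ≤ C

/-- A δ-separated set. -/
def Separated (δ : ℝ) (E : Set R3) : Prop :=
  ∀ x ∈ E, ∀ y ∈ E, x ≠ y → δ ≤ dist x y

/-- The directional multiplicity of 𝕋 at scale σ is at most m: at most m of the
tubes have directions in any cap of radius σ. -/
def DirMultLE (σ : ℝ) (𝕋 : Set Tube) (m : ℝ) : Prop :=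
  ∀ ω : R3, (({T ∈ 𝕋 | dist T.dir ω ≤ σ}.ncard : ℝ)) ≤ m

/-- The multiplicity function ∑_{T ∈ 𝕋} χ_T of a collection of σ-tubes. -/
def tubeCount (σ : ℝ) (𝕋 : Set Tube) (x : R3) : ℝ :=
  (({T ∈ 𝕋 | x ∈ T.set σ}).ncard : ℝ)

/-- The L^p norm ‖∑_{T ∈ 𝕋} χ_T‖_{L^p(ℝ³)}. -/
def tubeNorm (σ p : ℝ) (𝕋 : Set Tube) : ℝ≥0∞ :=
  (∫⁻ x : R3, ENNReal.ofReal (tubeCount σ 𝕋 x ^ p)) ^ (1 / p)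

/-- An X-ray estimate at dimension d with exponents α, β and constant A₀:
for every 0 < δ < 1, every δ-separated set of directions 𝓔 and every collection 𝕋 of
essentially distinct δ-tubes pointing in directions in 𝓔,
‖∑_{T∈𝕋} χ_T‖_{d'} ≤ A₀ δ^{1-3/d} m^{1-β} (δ² #𝓔)^α where m bounds the directional
multiplicity of 𝕋 and d' = d/(d-1). -/
def XRayEstimate (Ceq d α β A₀ : ℝ) : Prop :=
  ∀ δ : ℝ, 0 < δ → δ < 1 →
    ∀ 𝓔 : Set R3, (∀ v ∈ 𝓔, IsDirection v) → Separated δ 𝓔 → 𝓔.Finite →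
      ∀ 𝕋 : Set Tube, EssDistinct Ceq δ 𝕋 → (∀ T ∈ 𝕋, T.dir ∈ 𝓔) →
        ∀ m : ℝ, DirMultLE δ 𝕋 m →
          tubeNorm δ (d / (d - 1)) 𝕋 ≤
            ENNReal.ofReal (A₀ * δ ^ (1 - 3 / d) * m ^ (1 - β) * (δ ^ 2 * 𝓔.ncard) ^ α)

/-- A Kakeya estimate at dimension d with exponent α and constant A₀ (the β = 0
case of the X-ray estimate). -/
def KakeyaEstimate (Ceq d α A₀ : ℝ) : Prop :=
  ∀ δ : ℝ, 0 < δ → δ < 1 →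
    ∀ 𝓔 : Set R3, (∀ v ∈ 𝓔, IsDirection v) → Separated δ 𝓔 → 𝓔.Finite →
      ∀ 𝕋 : Set Tube, EssDistinct Ceq δ 𝕋 → (∀ T ∈ 𝕋, T.dir ∈ 𝓔) →
        ∀ m : ℝ, DirMultLE δ 𝕋 m →
          tubeNorm δ (d / (d - 1)) 𝕋 ≤
            ENNReal.ofReal (A₀ * δ ^ (1 - 3 / d) * m * (δ ^ 2 * 𝓔.ncard) ^ α)

/-- A collection 𝕋 of σ-tubes is sticky with constants (A, C) (relative to ε):
it is direction-separated at scale σ (directional multiplicity ≤ A σ^{-Cε}),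
has cardinality ≈ σ^{-2}, and there is a direction-separated collection 𝕋p of
σ^{1/2}-tubes of cardinality ≈ σ^{-1} (the parent tubes), together with an
assignment par : 𝕋 → 𝕋p such that each T ∈ 𝕋 is contained in its parent tube
and each parent has ≈ σ^{-1} children. -/
def StickyWith (A C ε σ : ℝ) (𝕋 𝕋p : Set Tube) (par : Tube → Tube) : Prop :=
  𝕋.Finite ∧ 𝕋p.Finite ∧
  DirMultLE σ 𝕋 (A * σ ^ (-(C * ε))) ∧
  DirMultLE (σ ^ (1/2 : ℝ)) 𝕋p (A * σ ^ (-(C * ε))) ∧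
  A⁻¹ * σ ^ (C * ε) * σ ^ (-2 : ℝ) ≤ (𝕋.ncard : ℝ) ∧
  (𝕋.ncard : ℝ) ≤ A * σ ^ (-(C * ε)) * σ ^ (-2 : ℝ) ∧
  A⁻¹ * σ ^ (C * ε) * σ ^ (-1 : ℝ) ≤ (𝕋p.ncard : ℝ) ∧
  (𝕋p.ncard : ℝ) ≤ A * σ ^ (-(C * ε)) * σ ^ (-1 : ℝ) ∧
  (∀ T ∈ 𝕋, par T ∈ 𝕋p ∧ T.set σ ⊆ (par T).set (σ ^ (1/2 : ℝ))) ∧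
  (∀ Tp ∈ 𝕋p,
    A⁻¹ * σ ^ (C * ε) * σ ^ (-1 : ℝ) ≤ ({T ∈ 𝕋 | par T = Tp}.ncard : ℝ) ∧
    ({T ∈ 𝕋 | par T = Tp}.ncard : ℝ) ≤ A * σ ^ (-(C * ε)) * σ ^ (-1 : ℝ))


/-- A sheared box has the volume of the corresponding straight box. -/
lemma volume_sheared_box (a b v w s t t' : ℝ) :
    volume {x : R3 | |x 0 - a - x 2 * v| < s ∧ |x 1 - b - x 2 * w| < s ∧ t < x 2 ∧ x 2 < t'} =
      ENNReal.ofReal (2 * s) * ENNReal.ofReal (2 * s) * ENNReal.ofReal (t' - t) := by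
  let M : Matrix (Fin 3) (Fin 3) ℝ := !![1, 0, -v; 0, 1, -w; 0, 0, 1]
  let L := Matrix.toLin' M
  let P : Set (Fin 3 → ℝ) := Set.pi univ ![Ioo (a - s) (a + s), Ioo (b - s) (b + s), Ioo t t']
  have hdet : LinearMap.det L = 1 := by
    simp [L, M, LinearMap.det_toLin', Matrix.det_fin_three]
  have hset : {x : R3 | |x 0 - a - x 2 * v| < s ∧ |x 1 - b - x 2 * w| < s ∧ t < x 2 ∧ x 2 < t'} =
      (WithLp.ofLp : R3 → Fin 3 → ℝ) ⁻¹' (L ⁻¹' P) := by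
    ext x
    simp only [L, M, P, mem_ofPred_eq, mem_preimage, mem_univ_pi, Fin.forall_fin_succ, abs_lt,
      Matrix.toLin'_apply, Matrix.mulVec, dotProduct, Fin.sum_univ_three]
    simp
    grind
  have hP : MeasurableSet P := by
    refine MeasurableSet.univ_pi fun i => ?_
    fin_cases i <;> exact measurableSet_Ioo
  have hL : Measurable L := (LinearMap.continuous_of_finiteDimensional L).measurable
  rw [hset, (PiLp.volume_preserving_ofLp (Fin 3)).measure_preimage
    (hL hP).nullMeasurableSet, Measure.addHaar_preimage_linearMap _ (by rw [hdet]; norm_num), hdet]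
  simp only [P, volume_pi_pi, Fin.prod_univ_three]
  change ENNReal.ofReal |1⁻¹| * (volume (Ioo (a - s) (a + s)) * volume (Ioo (b - s) (b + s)) *
    volume (Ioo t t')) = _
  rw [Real.volume_Ioo, Real.volume_Ioo, Real.volume_Ioo, inv_one, abs_one, ENNReal.ofReal_one,
    one_mul, show a + s - (a - s) = 2 * s by ring, show b + s - (b - s) = 2 * s by ring]

lemma abs_coord_le_dist (x y : R3) (i : Fin 3) : |x i - y i| ≤ dist x y := by
  have := PiLp.norm_apply_le (x - y) i
  rwa [Real.norm_eq_abs, PiLp.sub_apply, ← dist_eq_norm] at this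

lemma dist_le_sum_abs (x y : R3) :
    dist x y ≤ |x 0 - y 0| + |x 1 - y 1| + |x 2 - y 2| := by
  rw [EuclideanSpace.dist_eq, Fin.sum_univ_three]
  simp only [Real.dist_eq, sq_abs]
  refine Real.sqrt_le_iff.mpr ⟨by positivity, ?_⟩
  rw [← sq_abs (x 0 - y 0), ← sq_abs (x 1 - y 1), ← sq_abs (x 2 - y 2)]
  nlinarith [abs_nonneg (x 0 - y 0), abs_nonneg (x 1 - y 1), abs_nonneg (x 2 - y 2),
    mul_nonneg (abs_nonneg (x 0 - y 0)) (abs_nonneg (x 1 - y 1)),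
    mul_nonneg (abs_nonneg (x 0 - y 0)) (abs_nonneg (x 2 - y 2)),
    mul_nonneg (abs_nonneg (x 1 - y 1)) (abs_nonneg (x 2 - y 2))]

lemma Tube.dir_two (T : Tube) : T.dir 2 = 1 := by
  simp [Tube.dir, T.h0, T.h1]

lemma Tube.isDirection (T : Tube) : IsDirection T.dir := ⟨T.dir_two, T.hx, T.hy⟩

lemma Tube.norm_dir_le (T : Tube) : ‖T.dir‖ ≤ 2 := by
  have h := dist_le_sum_abs T.dir 0
  have h2 := T.dir_two
  have hx := T.isDirection.2.1
  have hy := T.isDirection.2.2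
  rw [dist_zero_right] at h
  simp only [PiLp.zero_apply, sub_zero, h2, abs_one] at h
  linarith

lemma Tube.mem_set_iff (T : Tube) (σ : ℝ) (x : R3) :
    x ∈ T.set σ ↔ ∃ t : ℝ, 0 ≤ t ∧ t ≤ 1 ∧ dist x (T.p0 + t • T.dir) < σ := by
  rw [Tube.set, Metric.mem_thickening_iff, segment_eq_image']
  constructor
  · rintro ⟨z, ⟨t, ht, rfl⟩, hz⟩
    exact ⟨t, ht.1, ht.2, hz⟩
  · rintro ⟨t, h0, h1, hz⟩
    exact ⟨_, ⟨t, ⟨h0, h1⟩, rfl⟩, hz⟩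

lemma Tube.isOpen_set (T : Tube) (σ : ℝ) : IsOpen (T.set σ) := Metric.isOpen_thickening

lemma Tube.volume_inter_ball_le (T : Tube) {δ : ℝ} (y : R3) (r : ℝ) (hδ : 0 < δ) :
    volume (T.set δ ∩ ball y r) ≤ ENNReal.ofReal (32 * δ ^ 2 * r) := by
  have hsub : T.set δ ∩ ball y r ⊆ {x : R3 | |x 0 - T.p0 0 - x 2 * T.dir 0| < 2 * δ ∧
      |x 1 - T.p0 1 - x 2 * T.dir 1| < 2 * δ ∧ y 2 - r < x 2 ∧ x 2 < y 2 + r} := by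
    rintro x ⟨hx, hxy⟩
    obtain ⟨t, -, -, hd⟩ := (T.mem_set_iff δ x).1 hx
    have h0 := (abs_coord_le_dist x (T.p0 + t • T.dir) 0).trans_lt hd
    have h1 := (abs_coord_le_dist x (T.p0 + t • T.dir) 1).trans_lt hd
    have h2 := (abs_coord_le_dist x (T.p0 + t • T.dir) 2).trans_lt hd
    have h3 := (abs_coord_le_dist x y 2).trans_lt (mem_ball.1 hxy)
    have hv0 := T.isDirection.2.1
    have hv1 := T.isDirection.2.2
    simp only [PiLp.add_apply, PiLp.smul_apply, smul_eq_mul, T.dir_two, T.h0, zero_add,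
      mul_one] at h0 h1 h2
    have key : ∀ v : ℝ, |v| ≤ 1 / 10 → |(t - x 2) * v| ≤ δ := by
      intro v hv
      rw [abs_mul, abs_sub_comm]
      nlinarith [abs_nonneg (x 2 - t), abs_nonneg v]
    have k0 := key _ hv0
    have k1 := key _ hv1
    rw [abs_lt] at h0 h1 h3
    rw [abs_le] at k0 k1
    refine ⟨abs_lt.2 ⟨?_, ?_⟩, abs_lt.2 ⟨?_, ?_⟩, ?_, ?_⟩ <;> linarith
  refine (measure_mono hsub).trans ?_
  rw [volume_sheared_box, ← ENNReal.ofReal_mul (by positivity),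
    ← ENNReal.ofReal_mul (by positivity)]
  refine ENNReal.ofReal_le_ofReal (le_of_eq ?_)
  ring

lemma Tube.le_volume_set (T : Tube) {δ : ℝ} (hδ : 0 < δ) :
    ENNReal.ofReal (δ ^ 2) ≤ volume (T.set δ) := by
  have hsub : {x : R3 | |x 0 - T.p0 0 - x 2 * T.dir 0| < δ / 2 ∧
      |x 1 - T.p0 1 - x 2 * T.dir 1| < δ / 2 ∧ 0 < x 2 ∧ x 2 < 1} ⊆ T.set δ := by
    rintro x ⟨h0, h1, h2, h3⟩
    refine (T.mem_set_iff δ x).2 ⟨x 2, h2.le, h3.le, ?_⟩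
    refine (dist_le_sum_abs _ _).trans_lt ?_
    simp only [PiLp.add_apply, PiLp.smul_apply, smul_eq_mul, T.dir_two, T.h0, zero_add,
      mul_one, sub_self, abs_zero, add_zero, ← sub_sub]
    linarith
  refine le_trans (le_of_eq ?_) (measure_mono hsub)
  rw [volume_sheared_box, ← ENNReal.ofReal_mul (by positivity),
    ← ENNReal.ofReal_mul (by positivity)]
  congr 1
  ring

/-- Equivalent tubes have nearby directions. -/
lemma TubeEquiv.dist_dir_lt {C σ : ℝ} {T T' : Tube} (hσ : 0 < σ) (h : TubeEquiv C σ T T') :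
    dist T.dir T'.dir < 6 * C * σ := by
  have hp0 : T.p0 ∈ T'.set (C * σ) := by
    refine h.1 ((T.mem_set_iff σ _).2 ⟨0, le_rfl, zero_le_one, ?_⟩)
    simpa using hσ
  have hp1 : T.p1 ∈ T'.set (C * σ) := by
    refine h.1 ((T.mem_set_iff σ _).2 ⟨1, zero_le_one, le_rfl, ?_⟩)
    simpa [Tube.dir] using hσ
  obtain ⟨t, -, -, ht⟩ := (T'.mem_set_iff _ _).1 hp0
  obtain ⟨u, -, -, hu⟩ := (T'.mem_set_iff _ _).1 hp1
  have ht2 := (abs_coord_le_dist _ _ 2).trans_lt ht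
  have hu2 := (abs_coord_le_dist _ _ 2).trans_lt hu
  simp only [PiLp.add_apply, PiLp.smul_apply, smul_eq_mul, T'.dir_two, T.h0, T'.h0, T.h1, zero_add,
    mul_one, zero_sub, abs_neg] at ht2 hu2
  have e : T.dir - T'.dir = (T.p1 - (T'.p0 + u • T'.dir)) - (T.p0 - (T'.p0 + t • T'.dir))
      - (1 - u) • T'.dir - t • T'.dir := by
    rw [show T.dir = T.p1 - T.p0 from rfl]
    module
  rw [dist_eq_norm] at ht hu ⊢
  rw [e]
  have n1 : ‖(1 - u) • T'.dir‖ ≤ 2 * (C * σ) := by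
    rw [norm_smul, Real.norm_eq_abs]
    nlinarith [T'.norm_dir_le, norm_nonneg T'.dir, abs_nonneg (1 - u)]
  have n2 : ‖t • T'.dir‖ ≤ 2 * (C * σ) := by
    rw [norm_smul, Real.norm_eq_abs]
    nlinarith [T'.norm_dir_le, norm_nonneg T'.dir, abs_nonneg t]
  have := norm_sub_le ((T.p1 - (T'.p0 + u • T'.dir)) - (T.p0 - (T'.p0 + t • T'.dir))
      - (1 - u) • T'.dir) (t • T'.dir)
  have := norm_sub_le ((T.p1 - (T'.p0 + u • T'.dir)) - (T.p0 - (T'.p0 + t • T'.dir)))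
    ((1 - u) • T'.dir)
  have := norm_sub_le (T.p1 - (T'.p0 + u • T'.dir)) (T.p0 - (T'.p0 + t • T'.dir))
  linarith

lemma card_Icc_floor_le {a b : ℝ} (hab : a ≤ b) :
    ((Finset.Icc ⌊a⌋ ⌊b⌋).card : ℝ) ≤ b - a + 2 := by
  have h := Int.floor_mono hab
  rw [Int.card_Icc, ← Int.cast_natCast, Int.toNat_of_nonneg (by omega)]
  push_cast
  linarith [Int.floor_le b, Int.lt_floor_add_one a]

/-- A cap of radius `R ≥ s` is covered by `O((R / s) ^ 2)` caps of radius `s`. -/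
lemma DirMultLE.ncard_cap_le {s m R : ℝ} {𝕋 : Set Tube} (h : DirMultLE s 𝕋 m) (hfin : 𝕋.Finite)
    (hs : 0 < s) (hR : s ≤ R) (ω : R3) :
    ({T ∈ 𝕋 | dist T.dir ω ≤ R}.ncard : ℝ) ≤ 36 * (R / s) ^ 2 * m := by
  classical
  have hm : 0 ≤ m := (Nat.cast_nonneg _).trans (h ω)
  have hfinR : {T ∈ 𝕋 | dist T.dir ω ≤ R}.Finite := hfin.subset (sep_subset _ _)
  let S := hfinR.toFinset
  let I : Fin 3 → Finset ℤ := fun i =>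
    Finset.Icc ⌊(ω i - R) / (s / 2)⌋ ⌊(ω i + R) / (s / 2)⌋
  let f : Tube → ℤ × ℤ := fun T => (⌊T.dir 0 / (s / 2)⌋, ⌊T.dir 1 / (s / 2)⌋)
  have hI : ∀ i, ((I i).card : ℝ) ≤ 6 * (R / s) := by
    intro i
    refine (card_Icc_floor_le (by gcongr; linarith)).trans ?_
    have h1 : 1 ≤ R / s := (one_le_div hs).2 hR
    have h2 : (ω i + R) / (s / 2) - (ω i - R) / (s / 2) = 4 * (R / s) := by
      field_simp
      ring
    linarith
  have hmaps : ∀ T ∈ S, f T ∈ I 0 ×ˢ I 1 := by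
    intro T hT
    have hT' := (hfinR.mem_toFinset.1 hT).2
    have h0 := abs_le.1 ((abs_coord_le_dist T.dir ω 0).trans hT')
    have h1 := abs_le.1 ((abs_coord_le_dist T.dir ω 1).trans hT')
    simp only [f, I, Finset.mem_product, Finset.mem_Icc]
    refine ⟨⟨?_, ?_⟩, ?_, ?_⟩ <;> apply Int.floor_mono <;> gcongr <;> linarith
  have hfib : ∀ c ∈ I 0 ×ˢ I 1, ({T ∈ S | f T = c}.card : ℝ) ≤ m := by
    intro c _
    rcases Finset.eq_empty_or_nonempty {T ∈ S | f T = c} with he | ⟨T₀, hT₀⟩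
    · simpa [he] using hm
    refine le_trans ?_ (h T₀.dir)
    rw [← Set.ncard_coe_finset]
    refine Nat.cast_le.2 (Set.ncard_le_ncard ?_ (hfin.subset (sep_subset _ _)))
    intro T hT
    obtain ⟨hTS, hTc⟩ := Finset.mem_filter.1 hT
    have hcc : f T = f T₀ := hTc.trans (Finset.mem_filter.1 hT₀).2.symm
    refine ⟨(hfinR.mem_toFinset.1 hTS).1, (dist_le_sum_abs _ _).trans ?_⟩
    have key : ∀ x y : ℝ, ⌊x / (s / 2)⌋ = ⌊y / (s / 2)⌋ → |x - y| ≤ s / 2 := by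
      intro x y hxy
      have h1 := Int.abs_sub_lt_one_of_floor_eq_floor hxy
      rw [← sub_div, abs_div, abs_of_pos (half_pos hs), div_lt_one (half_pos hs)] at h1
      exact h1.le
    have k0 := key _ _ (congrArg Prod.fst hcc)
    have k1 := key _ _ (congrArg Prod.snd hcc)
    rw [T.dir_two, T₀.dir_two, sub_self, abs_zero]
    linarith
  have hcard : (S.card : ℝ) = ∑ c ∈ I 0 ×ˢ I 1, ({T ∈ S | f T = c}.card : ℝ) := by
    exact_mod_cast Finset.card_eq_sum_card_fiberwise hmaps
  rw [Set.ncard_eq_toFinset_card _ hfinR]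
  calc (S.card : ℝ) ≤ ∑ c ∈ I 0 ×ˢ I 1, m := hcard.trans_le (Finset.sum_le_sum hfib)
    _ = (I 0).card * (I 1).card * m := by
      rw [Finset.sum_const, Finset.card_product, nsmul_eq_mul]
      push_cast
      ring
    _ ≤ (6 * (R / s)) * (6 * (R / s)) * m := by
      have := hI 0
      have := hI 1
      have : 0 ≤ R / s := div_nonneg (hs.le.trans hR) hs.le
      gcongr
    _ = 36 * (R / s) ^ 2 * m := by ring

lemma DirMultLE.ncard_le {s m : ℝ} {𝕋 : Set Tube} (h : DirMultLE s 𝕋 m) (hfin : 𝕋.Finite)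
    (hs : 0 < s) (hs1 : s ≤ 1) : s ^ 2 * (𝕋.ncard : ℝ) ≤ 36 * m := by
  have hall : {T ∈ 𝕋 | dist T.dir !₂[(0 : ℝ), 0, 1] ≤ 1} = 𝕋 := by
    refine Set.Subset.antisymm (sep_subset _ _) fun T hT => ⟨hT, (dist_le_sum_abs _ _).trans ?_⟩
    have h0 := T.isDirection.2.1
    have h1 := T.isDirection.2.2
    simp [T.dir_two]
    linarith
  have := h.ncard_cap_le hfin hs hs1 !₂[(0 : ℝ), 0, 1]
  rw [hall] at this
  calc s ^ 2 * (𝕋.ncard : ℝ) ≤ s ^ 2 * (36 * (1 / s) ^ 2 * m) := by gcongr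
    _ = 36 * m := by field_simp

/-- Greedy colouring: if every point is related to fewer than `D` others, then `D` colours suffice
to separate related points. -/
lemma exists_coloring {ι : Type*} (r : ι → ι → Prop) (hr : ∀ a b, r a b → r b a)
    (hrefl : ∀ a, r a a) (S : Finset ι) (D : ℕ)
    (hD : ∀ a ∈ S, {b | b ∈ S ∧ r a b}.ncard ≤ D) :
    ∃ f : ι → ℕ, (∀ a ∈ S, f a < D) ∧ ∀ a ∈ S, ∀ b ∈ S, r a b → f a = f b → a = b := by
  classical
  induction S using Finset.induction_on with
  | empty => exact ⟨fun _ => 0, by simp, by simp⟩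
  | insert a S ha ih =>
    have hfin : {b | b ∈ insert a S ∧ r a b}.Finite :=
      (insert a S).finite_toSet.subset fun c hc => hc.1
    obtain ⟨f, hf, hfS⟩ := ih (by
      intro b hb
      refine le_trans (Set.ncard_le_ncard ?_ ?_) (hD b (Finset.mem_insert_of_mem hb))
      · exact fun c hc => ⟨Finset.mem_insert_of_mem hc.1, hc.2⟩
      · exact (insert a S).finite_toSet.subset fun c hc => hc.1)
    have hlt : (({b ∈ S | r a b}).image f).card < (Finset.range D).card := by
      refine Finset.card_image_le.trans_lt ?_
      rw [Finset.card_range]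
      refine lt_of_lt_of_le ?_ (hD a (Finset.mem_insert_self a S))
      rw [← Set.ncard_coe_finset]
      have hss : (({b ∈ S | r a b} : Finset ι) : Set ι) ⊂ {b | b ∈ insert a S ∧ r a b} := by
        rw [Set.ssubset_iff_of_subset]
        · exact ⟨a, ⟨Finset.mem_insert_self a S, hrefl a⟩, by simp [ha]⟩
        · intro c hc
          obtain ⟨h1, h2⟩ := Finset.mem_filter.1 hc
          exact ⟨Finset.mem_insert_of_mem h1, h2⟩
      exact Set.ncard_lt_ncard hss hfin
    obtain ⟨c, hcD, hc⟩ := Finset.exists_mem_notMem_of_card_lt_card hlt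
    have hc' : ∀ b ∈ S, r a b → f b ≠ c := fun b hb hab h =>
      hc (Finset.mem_image.2 ⟨b, Finset.mem_filter.2 ⟨hb, hab⟩, h⟩)
    have hne : ∀ b ∈ S, b ≠ a := fun b hb h => ha (h ▸ hb)
    refine ⟨Function.update f a c, ?_, ?_⟩
    · intro b hb
      rcases Finset.mem_insert.1 hb with rfl | hb
      · simpa using hcD
      · simpa [hne b hb] using hf b hb
    · intro x hx y hy hxy hfxy
      rcases Finset.mem_insert.1 hx with rfl | hxS <;> rcases Finset.mem_insert.1 hy with rfl | hyS
      · rfl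
      · simp only [Function.update_self, Function.update_of_ne (hne y hyS)] at hfxy
        exact absurd hfxy.symm (hc' y hyS hxy)
      · simp only [Function.update_self, Function.update_of_ne (hne x hxS)] at hfxy
        exact absurd hfxy (hc' x hxS (hr _ _ hxy))
      · simp only [Function.update_of_ne (hne x hxS), Function.update_of_ne (hne y hyS)] at hfxy
        exact hfS x hxS y hyS hxy hfxy

lemma volume_R3_ball (x : R3) {r : ℝ} (hr : 0 ≤ r) :
    ENNReal.ofReal (4 * r ^ 3) ≤ volume (ball x r) ∧
      volume (ball x r) ≤ ENNReal.ofReal (5 * r ^ 3) := by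
  have h3 := Real.pi_gt_three
  have h4 := Real.pi_lt_d2
  have hr3 : 0 ≤ r ^ 3 := by positivity
  rw [EuclideanSpace.volume_ball_fin_three, ← ENNReal.ofReal_pow hr, ← ENNReal.ofReal_mul hr3]
  constructor <;> apply ENNReal.ofReal_le_ofReal <;> nlinarith

lemma measurableSet_dist_lt (r : ℝ) : MeasurableSet {p : R3 × R3 | dist p.2 p.1 < r} :=
  (isOpen_lt (continuous_snd.dist continuous_fst) continuous_const).measurableSet

/-- The part of a tube within a set `Y` is controlled by the part of its thickening within a
neighbourhood of `Y`. -/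
lemma Tube.volume_inter_le_thicken (T : Tube) {δ r : ℝ} (hδ : 0 < δ) (hr : δ ≤ r) {Y Y' : Set R3}
    (hY : MeasurableSet Y) (hY' : MeasurableSet Y') (hYY' : ∀ x ∈ Y, ball x r ⊆ Y') :
    ENNReal.ofReal (4 * r ^ 3) * volume (T.set δ ∩ Y) ≤
      ENNReal.ofReal (32 * δ ^ 2 * r) * volume (T.set (2 * r) ∩ Y') := by
  let W : Set (R3 × R3) := {p | p.1 ∈ T.set δ ∩ Y ∧ dist p.2 p.1 < r}
  have hTY : MeasurableSet (T.set δ ∩ Y) := (T.isOpen_set δ).measurableSet.inter hY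
  have hTY' : MeasurableSet (T.set (2 * r) ∩ Y') := (T.isOpen_set _).measurableSet.inter hY'
  have hW : MeasurableSet W :=
    (measurable_fst hTY).inter (measurableSet_dist_lt _)
  calc ENNReal.ofReal (4 * r ^ 3) * volume (T.set δ ∩ Y)
      = ∫⁻ x, (T.set δ ∩ Y).indicator (fun _ => ENNReal.ofReal (4 * r ^ 3)) x := by
        rw [lintegral_indicator hTY, setLIntegral_const]
    _ ≤ ∫⁻ x, volume (Prod.mk x ⁻¹' W) := by
        refine lintegral_mono fun x => ?_
        by_cases hx : x ∈ T.set δ ∩ Y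
        · rw [indicator_of_mem hx]
          refine (volume_R3_ball x (hδ.le.trans hr)).1.trans (measure_mono fun y hy => ?_)
          exact ⟨hx, mem_ball.1 hy⟩
        · rw [indicator_of_notMem hx]
          exact bot_le
    _ = ∫⁻ y, volume ((fun x => (x, y)) ⁻¹' W) := by
        rw [← Measure.prod_apply hW, Measure.prod_apply_symm hW]
    _ ≤ ∫⁻ y, (T.set (2 * r) ∩ Y').indicator (fun _ => ENNReal.ofReal (32 * δ ^ 2 * r)) y := by
        refine lintegral_mono fun y => ?_
        by_cases hy : y ∈ T.set (2 * r) ∩ Y'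
        · rw [indicator_of_mem hy]
          refine (measure_mono fun x hx => ?_).trans (T.volume_inter_ball_le y r hδ)
          exact ⟨hx.1.1, mem_ball'.2 hx.2⟩
        · rw [indicator_of_notMem hy, nonpos_iff_eq_zero]
          refine measure_mono_null (fun x hx => hy ⟨?_, hYY' x hx.1.2 hx.2⟩) measure_empty
          obtain ⟨t, h0, h1, ht⟩ := (T.mem_set_iff _ _).1 hx.1.1
          refine (T.mem_set_iff _ _).2 ⟨t, h0, h1, ?_⟩
          have hd : dist y x < r := hx.2
          linarith [dist_triangle y x (T.p0 + t • T.dir)]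
    _ = ENNReal.ofReal (32 * δ ^ 2 * r) * volume (T.set (2 * r) ∩ Y') := by
        rw [lintegral_indicator hTY', setLIntegral_const]

lemma measurable_volume_inter_ball {E : Set R3} (hE : MeasurableSet E) (s : ℝ) :
    Measurable fun x => volume (E ∩ ball x s) := by
  have hW : MeasurableSet {p : R3 × R3 | p.2 ∈ E ∧ dist p.2 p.1 < s} :=
    (measurable_snd hE).inter (measurableSet_dist_lt _)
  exact measurable_measure_prodMk_left hW

/-- Chebyshev bound for the set of centres of balls rich in `E`. -/
lemma mul_volume_rich_le {E : Set R3} (hE : MeasurableSet E) {s : ℝ} (hs : 0 ≤ s) (l : ℝ≥0∞) :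
    l * volume {x | l < volume (E ∩ ball x s)} ≤ ENNReal.ofReal (5 * s ^ 3) * volume E := by
  have hW : MeasurableSet {p : R3 × R3 | p.2 ∈ E ∧ dist p.2 p.1 < s} :=
    (measurable_snd hE).inter (measurableSet_dist_lt _)
  calc l * volume {x | l < volume (E ∩ ball x s)}
      ≤ l * volume {x | l ≤ volume (E ∩ ball x s)} := by
        gcongr
        exact fun h => le_of_lt h
    _ ≤ ∫⁻ x, volume (E ∩ ball x s) :=
        mul_meas_ge_le_lintegral (measurable_volume_inter_ball hE s) l
    _ = ∫⁻ y, volume ((fun x => (x, y)) ⁻¹' {p : R3 × R3 | p.2 ∈ E ∧ dist p.2 p.1 < s}) := by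
        rw [← Measure.prod_apply_symm hW, Measure.prod_apply hW]
        rfl
    _ ≤ ∫⁻ y, E.indicator (fun _ => ENNReal.ofReal (5 * s ^ 3)) y := by
        refine lintegral_mono fun y => ?_
        by_cases hy : y ∈ E
        · rw [indicator_of_mem hy]
          refine (measure_mono fun x hx => ?_).trans (volume_R3_ball y hs).2
          exact mem_ball'.2 hx.2
        · rw [indicator_of_notMem hy, nonpos_iff_eq_zero]
          exact measure_mono_null (fun x hx => hy hx.1) measure_empty
    _ = ENNReal.ofReal (5 * s ^ 3) * volume E := by
        rw [lintegral_indicator hE, setLIntegral_const]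

lemma tubeCount_eq_sum (ρ : ℝ) (S : Finset Tube) (x : R3) :
    ENNReal.ofReal (tubeCount ρ S x) = ∑ T ∈ S, (T.set ρ).indicator 1 x := by
  classical
  have hset : {T : Tube | T ∈ (S : Set Tube) ∧ x ∈ T.set ρ} =
      ({T ∈ S | x ∈ T.set ρ} : Finset Tube) := by
    ext T
    simp
  simp only [tubeCount, indicator_apply, Pi.one_apply]
  rw [hset, Set.ncard_coe_finset, ENNReal.ofReal_natCast, Finset.sum_boole]

/-- Dual form of a Kakeya estimate, for tubes with well separated directions. -/
lemma KakeyaEstimate.sum_volume_inter_le {Ceq d α A₀ : ℝ} (hCeq : 1 ≤ Ceq) (hd : 2 < d)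
    (hα : 0 < α) (hα1 : α < 1) (hA₀ : 0 < A₀) (hK : KakeyaEstimate Ceq d α A₀) {ρ : ℝ}
    (hρ : 0 < ρ) (hρ1 : ρ < 1) (S : Finset Tube)
    (hsep : ∀ T ∈ S, ∀ T' ∈ S, dist T.dir T'.dir < 6 * Ceq * ρ → T = T')
    {Y : Set R3} (hY : MeasurableSet Y) :
    ∑ T ∈ S, volume (T.set ρ ∩ Y) ≤
      volume Y ^ (1 / d) * ENNReal.ofReal (36 * A₀ * ρ ^ (1 - 3 / d)) := by
  have hmult : DirMultLE ρ (S : Set Tube) 1 := by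
    intro ω
    have hone : {T | T ∈ (S : Set Tube) ∧ dist T.dir ω ≤ ρ}.ncard ≤ 1 := by
      refine (Set.ncard_le_one (S.finite_toSet.subset (sep_subset _ _))).2 ?_
      rintro T ⟨hT, hTω⟩ T' ⟨hT', hTω'⟩
      refine hsep T hT T' hT' ?_
      have := dist_triangle_right T.dir T'.dir ω
      nlinarith
    exact_mod_cast hone
  have hess : EssDistinct Ceq ρ (S : Set Tube) := by
    refine ⟨S.finite_toSet, fun T hT => ?_⟩
    have he : {T' | T' ∈ (S : Set Tube) ∧ T' ≠ T ∧ TubeEquiv Ceq ρ T T'} = ∅ := by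
      refine eq_empty_of_forall_notMem ?_
      rintro T' ⟨hT', hne, heq⟩
      exact hne (hsep T hT T' hT' (heq.dist_dir_lt hρ)).symm
    rw [he, ncard_empty]
    push_cast
    linarith
  have hnorm := hK ρ hρ hρ1 (Tube.dir '' S) (by rintro _ ⟨T, -, rfl⟩; exact T.isDirection)
    (by
      rintro _ ⟨T, hT, rfl⟩ _ ⟨T', hT', rfl⟩ hne
      by_contra! hlt
      refine hne (congrArg _ (hsep T hT T' hT' ?_))
      nlinarith)
    (S.finite_toSet.image _) S hess (fun T hT => mem_image_of_mem _ hT) 1 hmult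
  have hcard : ρ ^ 2 * ((Tube.dir '' (S : Set Tube)).ncard : ℝ) ≤ 36 := by
    have h1 := hmult.ncard_le S.finite_toSet hρ hρ1.le
    have h2 : ((Tube.dir '' (S : Set Tube)).ncard : ℝ) ≤ (S : Set Tube).ncard :=
      Nat.cast_le.2 (Set.ncard_image_le S.finite_toSet)
    nlinarith [sq_nonneg ρ]
  have hpow : (ρ ^ 2 * ((Tube.dir '' (S : Set Tube)).ncard : ℝ)) ^ α ≤ 36 :=
    calc _ ≤ (36 : ℝ) ^ α := Real.rpow_le_rpow (by positivity) hcard hα.le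
      _ ≤ (36 : ℝ) ^ (1 : ℝ) := Real.rpow_le_rpow_of_exponent_le (by norm_num) hα1.le
      _ = 36 := Real.rpow_one _
  have hnorm' : tubeNorm ρ (d / (d - 1)) S ≤ ENNReal.ofReal (36 * A₀ * ρ ^ (1 - 3 / d)) := by
    refine hnorm.trans (ENNReal.ofReal_le_ofReal ?_)
    have : 0 ≤ A₀ * ρ ^ (1 - 3 / d) := by positivity
    nlinarith
  have hmeas : Measurable fun x => ENNReal.ofReal (tubeCount ρ S x) := by
    simp only [tubeCount_eq_sum]
    exact Finset.measurable_fun_sum _ fun T _ =>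
      measurable_one.indicator (T.isOpen_set ρ).measurableSet
  have hconj : d.HolderConjugate (d / (d - 1)) := Real.HolderConjugate.conjExponent (by linarith)
  calc ∑ T ∈ S, volume (T.set ρ ∩ Y)
      = ∫⁻ x, ((Y.indicator 1 : R3 → ℝ≥0∞) * fun x => ENNReal.ofReal (tubeCount ρ S x)) x := by
        have : ∀ x, ((Y.indicator 1 : R3 → ℝ≥0∞) * fun x => ENNReal.ofReal (tubeCount ρ S x)) x =
            ∑ T ∈ S, (T.set ρ ∩ Y).indicator 1 x := by
          intro x
          rw [Pi.mul_apply, tubeCount_eq_sum, Finset.mul_sum]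
          refine Finset.sum_congr rfl fun T _ => ?_
          rw [inter_comm, inter_indicator_one, Pi.mul_apply]
        simp only [this]
        have hm : ∀ T ∈ S, MeasurableSet (T.set ρ ∩ Y) := fun T _ =>
          (T.isOpen_set ρ).measurableSet.inter hY
        rw [lintegral_finsetSum _ fun T hT => measurable_one.indicator (hm T hT)]
        exact Finset.sum_congr rfl fun T hT => (lintegral_indicator_one (hm T hT)).symm
    _ ≤ (∫⁻ x, (Y.indicator 1 : R3 → ℝ≥0∞) x ^ d) ^ (1 / d) *
        (∫⁻ x, ENNReal.ofReal (tubeCount ρ S x) ^ (d / (d - 1))) ^ (1 / (d / (d - 1))) :=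
        ENNReal.lintegral_mul_le_Lp_mul_Lq _ hconj (measurable_one.indicator hY).aemeasurable
          hmeas.aemeasurable
    _ = volume Y ^ (1 / d) * tubeNorm ρ (d / (d - 1)) S := by
        congr 2
        · rw [← lintegral_indicator_one hY]
          refine lintegral_congr fun x => ?_
          by_cases hx : x ∈ Y
          · simp [hx]
          · simp [hx, show 0 < d by linarith]
        · refine lintegral_congr fun x => ?_
          exact ENNReal.ofReal_rpow_of_nonneg (Nat.cast_nonneg _) hconj.symm.nonneg
    _ ≤ _ := by gcongr

/-- Dual form of a Kakeya estimate, for tubes with bounded directional multiplicity. -/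
lemma KakeyaEstimate.sum_volume_inter_le_mul {Ceq d α A₀ : ℝ} (hCeq : 1 ≤ Ceq) (hd : 2 < d)
    (hα : 0 < α) (hα1 : α < 1) (hA₀ : 0 < A₀) (hK : KakeyaEstimate Ceq d α A₀) {ρ : ℝ}
    (hρ : 0 < ρ) (hρ1 : ρ < 1) (S : Finset Tube) {D : ℝ}
    (hD : DirMultLE (6 * Ceq * ρ) (S : Set Tube) D)
    {Y : Set R3} (hY : MeasurableSet Y) :
    ∑ T ∈ S, volume (T.set ρ ∩ Y) ≤
      ENNReal.ofReal D * (volume Y ^ (1 / d) * ENNReal.ofReal (36 * A₀ * ρ ^ (1 - 3 / d))) := by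
  classical
  have hD0 : 0 ≤ D := (Nat.cast_nonneg _).trans (hD 0)
  obtain ⟨f, hfD, hf⟩ := exists_coloring
    (fun T T' : Tube => dist T.dir T'.dir < 6 * Ceq * ρ) (fun T T' h => by rwa [dist_comm])
    (fun T => by rw [dist_self]; positivity) S ⌊D⌋₊ (fun T hT => by
      refine Nat.le_floor (le_trans (Nat.cast_le.2 ?_) (hD T.dir))
      refine Set.ncard_le_ncard ?_ (S.finite_toSet.subset (sep_subset _ _))
      rintro T' ⟨hT', hlt⟩
      exact ⟨hT', by rw [dist_comm]; exact hlt.le⟩)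
  rw [← Finset.sum_fiberwise_of_maps_to (t := Finset.range ⌊D⌋₊) (g := f)
    fun T hT => Finset.mem_range.2 (hfD T hT)]
  calc _ ≤ ∑ _j ∈ Finset.range ⌊D⌋₊,
        (volume Y ^ (1 / d) * ENNReal.ofReal (36 * A₀ * ρ ^ (1 - 3 / d))) := by
        refine Finset.sum_le_sum fun j _ =>
          hK.sum_volume_inter_le hCeq hd hα hα1 hA₀ hρ hρ1 _ ?_ hY
        intro T hT T' hT' hlt
        rw [Finset.mem_filter] at hT hT'
        exact hf T hT.1 T' hT'.1 hlt (hT.2.trans hT'.2.symm)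
    _ = (⌊D⌋₊ : ℝ≥0∞) * (volume Y ^ (1 / d) * ENNReal.ofReal (36 * A₀ * ρ ^ (1 - 3 / d))) := by
        rw [Finset.sum_const, Finset.card_range, nsmul_eq_mul]
    _ ≤ _ := by
        gcongr
        rw [← ENNReal.ofReal_natCast]
        exact ENNReal.ofReal_le_ofReal (Nat.floor_le hD0)

/-- Total measure of the parts of the tubes around which the balls of radius `r` are rich in `E`. -/
lemma KakeyaEstimate.sum_volume_rich_le {Ceq d α A₀ : ℝ} (hCeq : 1 ≤ Ceq) (hd : 2 < d)
    (hα : 0 < α) (hα1 : α < 1) (hA₀ : 0 < A₀) (hK : KakeyaEstimate Ceq d α A₀) {δ r : ℝ}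
    (hδ : 0 < δ) (hδr : δ ≤ r) (hr : r < 1 / 2) (S : Finset Tube) {m V l : ℝ}
    (hm : DirMultLE δ (S : Set Tube) m) (hl : 0 < l) {E : Set R3} (hE : MeasurableSet E)
    (hV : 0 ≤ V) (hEV : volume E ≤ ENNReal.ofReal V) :
    ∑ T ∈ S, volume (T.set δ ∩ {x | ENNReal.ofReal l < volume (E ∩ ball x r)}) ≤
      ENNReal.ofReal (1492992 * Ceq ^ 2 * A₀ * m * (40 * r ^ 3 * V / l) ^ (1 / d) *
        (2 * r) ^ (1 - 3 / d)) := by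
  have hr0 : 0 < r := hδ.trans_le hδr
  have hm0 : 0 ≤ m := (Nat.cast_nonneg _).trans (hm 0)
  set Y := {x | ENNReal.ofReal l < volume (E ∩ ball x r)}
  set Y' := {x | ENNReal.ofReal l < volume (E ∩ ball x (2 * r))}
  have hY : MeasurableSet Y := measurableSet_lt measurable_const (measurable_volume_inter_ball hE r)
  have hY' : MeasurableSet Y' :=
    measurableSet_lt measurable_const (measurable_volume_inter_ball hE _)
  have hYY' : ∀ x ∈ Y, ball x r ⊆ Y' := by
    intro x hx y hy
    refine lt_of_lt_of_le (show ENNReal.ofReal l < volume (E ∩ ball x r) from hx) (measure_mono ?_)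
    refine inter_subset_inter_right _ (ball_subset_ball' ?_)
    have := mem_ball'.1 hy
    linarith
  have hvolY' : volume Y' ≤ ENNReal.ofReal (40 * r ^ 3 * V / l) := by
    rw [ENNReal.ofReal_div_of_pos hl, ENNReal.le_div_iff_mul_le (by simp [hl]) (by simp), mul_comm]
    refine (mul_volume_rich_le hE (by positivity) _).trans ?_
    refine (mul_le_mul_right hEV _).trans (le_of_eq ?_)
    rw [← ENNReal.ofReal_mul (by positivity)]
    congr 1
    ring
  have hD : DirMultLE (6 * Ceq * (2 * r)) (S : Set Tube) (36 * (6 * Ceq * (2 * r) / δ) ^ 2 * m) :=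
    fun ω => hm.ncard_cap_le S.finite_toSet hδ (by nlinarith) ω
  have hsum := hK.sum_volume_inter_le_mul hCeq hd hα hα1 hA₀ (by positivity) (by linarith) S hD hY'
  have hX : ∑ T ∈ S, volume (T.set (2 * r) ∩ Y') ≤
      ENNReal.ofReal (36 * (6 * Ceq * (2 * r) / δ) ^ 2 * m * ((40 * r ^ 3 * V / l) ^ (1 / d) *
        (36 * A₀ * (2 * r) ^ (1 - 3 / d)))) := by
    refine hsum.trans ?_
    rw [ENNReal.ofReal_mul (p := 36 * _ * m) (by positivity),
      ENNReal.ofReal_mul (p := (40 * r ^ 3 * V / l) ^ (1 / d)) (by positivity),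
      ← ENNReal.ofReal_rpow_of_nonneg (by positivity) (by positivity)]
    gcongr
  have hmain : ENNReal.ofReal (4 * r ^ 3) * ∑ T ∈ S, volume (T.set δ ∩ Y) ≤
      ENNReal.ofReal (32 * δ ^ 2 * r) * ∑ T ∈ S, volume (T.set (2 * r) ∩ Y') := by
    rw [Finset.mul_sum, Finset.mul_sum]
    exact Finset.sum_le_sum fun T _ => T.volume_inter_le_thicken hδ hδr hY hY' hYY'
  have h4 : 0 < 4 * r ^ 3 := by positivity
  refine (ENNReal.mul_le_mul_iff_right (ENNReal.ofReal_pos.2 h4).ne' ENNReal.ofReal_ne_top).1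
    (hmain.trans ?_)
  rw [← ENNReal.ofReal_mul h4.le]
  refine (mul_le_mul_right hX _).trans ?_
  rw [← ENNReal.ofReal_mul (by positivity)]
  refine ENNReal.ofReal_le_ofReal (le_of_eq ?_)
  generalize (40 * r ^ 3 * V / l) ^ (1 / d) = a
  generalize (2 * r) ^ (1 - 3 / d) = b
  field_simp
  ring

lemma exists_dyadic_scale {δ σ : ℝ} (hδ : 0 < δ) (h : δ ≤ σ) :
    ∃ k : ℕ, 2 ^ k * δ ≤ σ ∧ σ < 2 * (2 ^ k * δ) := by
  obtain ⟨k, h1, h2⟩ := exists_nat_pow_near ((one_le_div hδ).2 h) one_lt_two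
  refine ⟨k, (le_div_iff₀ hδ).1 h1, ?_⟩
  have := (div_lt_iff₀ hδ).1 h2
  rw [pow_succ] at this
  linarith

lemma dyadic_scale_lt {δ ε : ℝ} (hδ : 0 < δ) (hε : 0 < ε) (hδε : δ ≤ (ε / 2) ^ (1 / ε)) {k : ℕ}
    (hk : 2 ^ k * δ < 1 / 2) : k < ⌊δ ^ (-(2 * ε))⌋₊ := by
  rw [← Nat.succ_le_iff, Nat.le_floor_iff (by positivity)]
  have h1 : (2 : ℝ) ^ (k + 1) ≤ δ⁻¹ := by
    rw [pow_succ, le_inv_comm₀ (by positivity) hδ, ← one_div, le_div_iff₀ (by positivity)]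
    linarith
  have h2 : ((k + 1 : ℕ) : ℝ) * Real.log 2 ≤ Real.log δ⁻¹ := by
    rw [← Real.log_pow]
    exact Real.log_le_log (by positivity) h1
  have h3 := Real.log_le_rpow_div (inv_nonneg.2 hδ.le) hε
  have h4 := Real.log_two_gt_d9
  have h5 : δ⁻¹ ^ ε = δ ^ (-ε) := by rw [Real.inv_rpow hδ.le, Real.rpow_neg hδ.le]
  have h6 : 2 / ε ≤ δ ^ (-ε) := by
    rw [Real.rpow_neg hδ.le, le_inv_comm₀ (by positivity) (by positivity), inv_div]
    calc δ ^ ε ≤ ((ε / 2) ^ (1 / ε)) ^ ε := by gcongr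
      _ = ε / 2 := by rw [← Real.rpow_mul (by positivity), one_div_mul_cancel hε.ne', Real.rpow_one]
  have h7 : δ ^ (-(2 * ε)) = δ ^ (-ε) * δ ^ (-ε) := by
    rw [← Real.rpow_add hδ]
    ring_nf
  rw [h5] at h3
  have h8 : 0 < δ ^ (-ε) := by positivity
  have h9 : ((k + 1 : ℕ) : ℝ) ≤ 2 * (δ ^ (-ε) / ε) := by
    have : (0 : ℝ) ≤ ((k + 1 : ℕ) : ℝ) := Nat.cast_nonneg _
    nlinarith
  rw [h7]
  calc ((k + 1 : ℕ) : ℝ) ≤ 2 * (δ ^ (-ε) / ε) := h9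
    _ = (2 / ε) * δ ^ (-ε) := by ring
    _ ≤ δ ^ (-ε) * δ ^ (-ε) := by gcongr

/-- The power count at a single scale. -/
lemma scale_power_le {d A A₁ C ε δ r : ℝ} (hd2 : 2 < d) (hd3 : d < 3) (hA : 0 < A)
    (hA₁ : A ≤ A₁) (hδ : 0 < δ) (hr : 0 < r) :
    (40 * r ^ 3 * (A * δ ^ (-(C * ε)) * δ ^ (3 - d)) /
      (A₁ * δ ^ (-√ε) * δ ^ (3 - d) * r ^ d)) ^ (1 / d) * (2 * r) ^ (1 - 3 / d) ≤
      40 * δ ^ ((√ε - C * ε) / d) := by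
  have hd : 0 < d := by linarith
  have hA1 : 0 < A₁ := hA.trans_le hA₁
  have h1 : 40 * r ^ 3 * (A * δ ^ (-(C * ε)) * δ ^ (3 - d)) /
      (A₁ * δ ^ (-√ε) * δ ^ (3 - d) * r ^ d) ≤ 40 * (δ ^ (√ε - C * ε) * r ^ (3 - d)) := by
    rw [div_le_iff₀ (by positivity)]
    have e1 : δ ^ (√ε - C * ε) * δ ^ (-√ε) = δ ^ (-(C * ε)) := by
      rw [← Real.rpow_add hδ]
      ring_nf
    have e2 : r ^ (3 - d) * r ^ d = r ^ 3 := by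
      rw [← Real.rpow_add hr, sub_add_cancel]
      norm_cast
    calc _ = 40 * A * (δ ^ (-(C * ε)) * δ ^ (3 - d) * r ^ 3) := by ring
      _ ≤ 40 * A₁ * (δ ^ (-(C * ε)) * δ ^ (3 - d) * r ^ 3) := by gcongr
      _ = _ := by
        rw [← e1, ← e2]
        ring
  have h40 : (40 : ℝ) ^ (1 / d) ≤ 40 := by
    calc (40 : ℝ) ^ (1 / d) ≤ (40 : ℝ) ^ (1 : ℝ) := by
          refine Real.rpow_le_rpow_of_exponent_le (by norm_num) ?_
          rw [div_le_one hd]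
          linarith
      _ = 40 := Real.rpow_one _
  have h2 : (2 * r) ^ (1 - 3 / d) ≤ r ^ (1 - 3 / d) := by
    refine Real.rpow_le_rpow_of_nonpos hr (by linarith) ?_
    rw [sub_nonpos, one_le_div hd]
    exact hd3.le
  have h3 : r ^ ((3 - d) / d) * r ^ (1 - 3 / d) = 1 := by
    rw [← Real.rpow_add hr, show (3 - d) / d + (1 - 3 / d) = 0 by field_simp; ring, Real.rpow_zero]
  calc _ ≤ (40 * (δ ^ (√ε - C * ε) * r ^ (3 - d))) ^ (1 / d) * r ^ (1 - 3 / d) := by gcongr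
    _ = 40 ^ (1 / d) * δ ^ ((√ε - C * ε) / d) * (r ^ ((3 - d) / d) * r ^ (1 - 3 / d)) := by
      rw [Real.mul_rpow (by positivity) (by positivity), Real.mul_rpow (by positivity)
        (by positivity), ← Real.rpow_mul hδ.le, ← Real.rpow_mul hr.le, mul_one_div, mul_one_div]
      ring
    _ ≤ 40 * δ ^ ((√ε - C * ε) / d) * 1 := by
      rw [h3]
      gcongr
    _ = _ := mul_one _

/-- Beyond the scale `1 / 2` no ball is rich, for volume reasons. -/
lemma volume_le_of_half_le {d A A₁ C ε δ r : ℝ} (hd : 0 < d) (hd3 : d < 3) (hA : 0 < A)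
    (hA₁ : 8 * A ≤ A₁) (hδ : 0 < δ) (hδ1 : δ < 1) (hCε : C * ε ≤ √ε) (hr : 1 / 2 ≤ r) :
    A * δ ^ (-(C * ε)) * δ ^ (3 - d) ≤ A₁ * δ ^ (-√ε) * δ ^ (3 - d) * r ^ d := by
  have h1 : δ ^ (-(C * ε)) ≤ δ ^ (-√ε) :=
    Real.rpow_le_rpow_of_exponent_ge hδ hδ1.le (by linarith)
  have h2 : 1 / 8 ≤ r ^ d :=
    calc (1 / 8 : ℝ) = (1 / 2) ^ (3 : ℝ) := by norm_num
      _ ≤ (1 / 2) ^ d := Real.rpow_le_rpow_of_exponent_ge (by norm_num) (by norm_num) hd3.le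
      _ ≤ r ^ d := Real.rpow_le_rpow (by norm_num) hr hd.le
  calc A * δ ^ (-(C * ε)) * δ ^ (3 - d) ≤ A * δ ^ (-√ε) * δ ^ (3 - d) := by gcongr
    _ = (8 * A) * δ ^ (-√ε) * δ ^ (3 - d) * (1 / 8) := by ring
    _ ≤ A₁ * δ ^ (-√ε) * δ ^ (3 - d) * r ^ d := by
      have : 0 ≤ A₁ := by linarith
      gcongr

/-- Proposition 6.2: given a Kakeya estimate at dimension d and a sticky collection 𝕋
of δ-tubes with |E_δ| ≲ δ^{3-d}, for most pairs (T, x) with T ∈ 𝕋 and x ∈ T the bound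
|E_δ ∩ B(x, C₂σ)| ≤ A₁ δ^{-√ε} δ^{3-d} σ^d holds simultaneously for all δ ≤ σ ≤ 1:
the total measure, summed over T ∈ 𝕋, of the exceptional points x ∈ T is at most
A₁ δ^{c√ε} ∑_{T∈𝕋} |T|. -/
theorem ball_volume_bound (Ceq d α A₀ A C : ℝ) (hCeq : 1 ≤ Ceq) (hd2 : 2 < d) (hd3 : d < 3)
    (hα : 0 < α) (hα1 : α < 1) (hA₀ : 0 < A₀) (hA : 0 < A) (hC : 0 < C)
    (hK : KakeyaEstimate Ceq d α A₀) :
    ∃ A₁ C₂ c ε₀ : ℝ, 0 < A₁ ∧ 0 < C₂ ∧ 0 < c ∧ 0 < ε₀ ∧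
      ∀ ε : ℝ, 0 < ε → ε < ε₀ →
        ∃ δ₀ : ℝ, 0 < δ₀ ∧ ∀ δ : ℝ, 0 < δ → δ < δ₀ →
          ∀ (𝕋 𝕋ρ : Set Tube) (par : Tube → Tube),
            StickyWith A C ε δ 𝕋 𝕋ρ par →
            volume (⋃ T ∈ 𝕋, T.set δ) ≤
              ENNReal.ofReal (A * δ ^ (-(C * ε)) * δ ^ (3 - d)) →
            (∑' T : 𝕋, volume {x ∈ (T : Tube).set δ |
                ∃ σ : ℝ, δ ≤ σ ∧ σ ≤ 1 ∧
                  ENNReal.ofReal (A₁ * δ ^ (-Real.sqrt ε) * δ ^ (3 - d) * σ ^ d) <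
                    volume ((⋃ T' ∈ 𝕋, T'.set δ) ∩ Metric.ball x (C₂ * σ))}) ≤
              ENNReal.ofReal (A₁ * δ ^ (c * Real.sqrt ε)) *
                ∑' T : 𝕋, volume ((T : Tube).set δ) := by
  set K : ℝ := 1492992 * Ceq ^ 2 * A₀ * A * 40 with hKdef
  have hd : 0 < d := by linarith
  have hK0 : 0 < K := by positivity
  set A₁ : ℝ := 8 * A + A * K with hA₁def
  have hA₁ : 0 < A₁ := by positivity
  have hA₁8 : 8 * A ≤ A₁ := le_add_of_nonneg_right (by positivity)
  refine ⟨A₁, 1 / 2, 1 / 6, (1 / (6 * (3 * C + 2))) ^ 2, hA₁, by norm_num, by norm_num,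
    by positivity, fun ε hε hε₀ => ⟨min 1 ((ε / 2) ^ (1 / ε)), by positivity, ?_⟩⟩
  rintro δ hδ hδ₀ 𝕋 𝕋ρ par ⟨hfin, -, hmult, -, hcard, -⟩ hvol
  have hδ1 : δ < 1 := hδ₀.trans_le (min_le_left _ _)
  have hsq : √ε * √ε = ε := Real.mul_self_sqrt hε.le
  have hs0 : 0 < √ε := Real.sqrt_pos.2 hε
  have hsε : √ε * (6 * (3 * C + 2)) ≤ 1 := by
    rw [← le_div_iff₀ (by positivity)]
    exact Real.sqrt_le_iff.2 ⟨by positivity, hε₀.le⟩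
  have hexp : ε * (6 * (3 * C + 2)) ≤ √ε := by
    calc ε * (6 * (3 * C + 2)) = √ε * (√ε * (6 * (3 * C + 2))) := by
          rw [← mul_assoc √ε, hsq]
      _ ≤ √ε := mul_le_of_le_one_right hs0.le hsε
  have hCε0 : 0 < C * ε := by positivity
  have hCε : C * ε ≤ √ε := by nlinarith
  obtain ⟨S, rfl⟩ := hfin.exists_finset_coe
  set E : Set R3 := ⋃ T ∈ (S : Set Tube), T.set δ
  have hE : MeasurableSet E :=
    (isOpen_biUnion fun (T : Tube) _ => T.isOpen_set δ).measurableSet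
  let l : ℝ → ℝ := fun r => A₁ * δ ^ (-√ε) * δ ^ (3 - d) * r ^ d
  let Y : ℕ → Set R3 := fun k =>
    {x | ENNReal.ofReal (l (2 ^ k * δ)) < volume (E ∩ ball x (2 ^ k * δ))}
  have hYempty : ∀ k, ¬ (2 ^ k * δ < 1 / 2) → Y k = ∅ := by
    intro k hk
    refine eq_empty_of_forall_notMem fun x hx => ?_
    refine absurd (lt_of_lt_of_le hx (measure_mono inter_subset_left)) (not_lt.2 (hvol.trans ?_))
    exact ENNReal.ofReal_le_ofReal
      (volume_le_of_half_le hd hd3 hA hA₁8 hδ hδ1 hCε (not_lt.1 hk))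
  set B : ℝ := K * δ ^ (-(C * ε)) * δ ^ ((√ε - C * ε) / d) with hBdef
  have hYsum : ∀ k, ∑ T ∈ S, volume (T.set δ ∩ Y k) ≤ ENNReal.ofReal B := by
    intro k
    by_cases hk : 2 ^ k * δ < 1 / 2
    · have hδr : δ ≤ 2 ^ k * δ := le_mul_of_one_le_left hδ.le (one_le_pow₀ one_le_two)
      have hr : 0 < 2 ^ k * δ := hδ.trans_le hδr
      refine (hK.sum_volume_rich_le hCeq hd2 hα hα1 hA₀ hδ hδr hk S hmult
        (by positivity : 0 < l (2 ^ k * δ)) hE (by positivity) hvol).trans ?_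
      refine ENNReal.ofReal_le_ofReal ?_
      have hp := scale_power_le (C := C) (ε := ε) hd2 hd3 hA (by linarith : A ≤ A₁) hδ hr
      calc _ = 1492992 * Ceq ^ 2 * A₀ * (A * δ ^ (-(C * ε))) *
            ((40 * (2 ^ k * δ) ^ 3 * (A * δ ^ (-(C * ε)) * δ ^ (3 - d)) /
              l (2 ^ k * δ)) ^ (1 / d) * (2 * (2 ^ k * δ)) ^ (1 - 3 / d)) := by ring
        _ ≤ 1492992 * Ceq ^ 2 * A₀ * (A * δ ^ (-(C * ε))) *
            (40 * δ ^ ((√ε - C * ε) / d)) := by gcongr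
        _ = B := by
          rw [hBdef, hKdef]
          ring
    · simp [hYempty k hk]
  have hcover : ∀ T : Tube, {x ∈ T.set δ | ∃ σ : ℝ, δ ≤ σ ∧ σ ≤ 1 ∧
      ENNReal.ofReal (A₁ * δ ^ (-√ε) * δ ^ (3 - d) * σ ^ d) <
        volume (E ∩ ball x (1 / 2 * σ))} ⊆
      ⋃ k ∈ Finset.range ⌊δ ^ (-(2 * ε))⌋₊, T.set δ ∩ Y k := by
    rintro T x ⟨hxT, σ, hσ, -, hlt⟩
    obtain ⟨k, hk1, hk2⟩ := exists_dyadic_scale hδ hσ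
    have hxY : x ∈ Y k := by
      refine (ENNReal.ofReal_le_ofReal ?_).trans_lt (hlt.trans_le (measure_mono
        (inter_subset_inter_right _ (ball_subset_ball (by linarith)))))
      change A₁ * δ ^ (-√ε) * δ ^ (3 - d) * (2 ^ k * δ) ^ d ≤ _
      gcongr
    have hk : 2 ^ k * δ < 1 / 2 := by
      by_contra h
      rw [hYempty k h] at hxY
      exact hxY
    exact mem_biUnion (Finset.mem_coe.2 (Finset.mem_range.2
      (dyadic_scale_lt hδ hε (hδ₀.le.trans (min_le_right _ _)) hk))) ⟨hxT, hxY⟩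
  rw [Finset.tsum_subtype' S fun T : Tube => volume (T.set δ),
    Finset.tsum_subtype' S fun T : Tube => volume {x ∈ T.set δ | ∃ σ : ℝ, δ ≤ σ ∧ σ ≤ 1 ∧
      ENNReal.ofReal (A₁ * δ ^ (-√ε) * δ ^ (3 - d) * σ ^ d) <
        volume (E ∩ ball x (1 / 2 * σ))}]
  rw [Set.ncard_coe_finset] at hcard
  have hlower : ENNReal.ofReal (A⁻¹ * δ ^ (C * ε)) ≤ ∑ T ∈ S, volume (T.set δ) := by
    calc ENNReal.ofReal (A⁻¹ * δ ^ (C * ε)) ≤ ENNReal.ofReal (S.card * δ ^ 2) := by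
          refine ENNReal.ofReal_le_ofReal ?_
          calc A⁻¹ * δ ^ (C * ε) = A⁻¹ * δ ^ (C * ε) * δ ^ (-2 : ℝ) * δ ^ 2 := by
                rw [mul_assoc _ (δ ^ (-2 : ℝ)), ← Real.rpow_two, ← Real.rpow_add hδ]
                norm_num
            _ ≤ S.card * δ ^ 2 := by gcongr
      _ = ∑ T ∈ S, ENNReal.ofReal (δ ^ 2) := by
          rw [Finset.sum_const, nsmul_eq_mul, ENNReal.ofReal_mul (Nat.cast_nonneg _),
            ENNReal.ofReal_natCast]
      _ ≤ _ := Finset.sum_le_sum fun T _ => T.le_volume_set hδ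
  have hpow : δ ^ (-(2 * ε)) * B ≤ A₁ * δ ^ (1 / 6 * √ε) * (A⁻¹ * δ ^ (C * ε)) := by
    have hdiv : (√ε - C * ε) / 3 ≤ (√ε - C * ε) / d :=
      div_le_div_of_nonneg_left (by linarith) hd hd3.le
    calc δ ^ (-(2 * ε)) * B
        = K * δ ^ (-(2 * ε) + -(C * ε) + (√ε - C * ε) / d) := by
          rw [hBdef, Real.rpow_add hδ, Real.rpow_add hδ]
          ring
      _ ≤ K * δ ^ (1 / 6 * √ε + C * ε) := by
          refine mul_le_mul_of_nonneg_left ?_ hK0.le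
          refine Real.rpow_le_rpow_of_exponent_ge hδ hδ1.le ?_
          linarith
      _ = (A * K) * A⁻¹ * δ ^ (1 / 6 * √ε + C * ε) := by field_simp
      _ ≤ A₁ * A⁻¹ * δ ^ (1 / 6 * √ε + C * ε) := by
          have : A * K ≤ A₁ := by linarith
          gcongr
      _ = _ := by
          rw [Real.rpow_add hδ]
          ring
  calc _ ≤ ∑ T ∈ S, ∑ k ∈ Finset.range ⌊δ ^ (-(2 * ε))⌋₊, volume (T.set δ ∩ Y k) :=
        Finset.sum_le_sum fun T _ =>
          (measure_mono (hcover T)).trans (measure_biUnion_finset_le _ _)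
    _ = ∑ k ∈ Finset.range ⌊δ ^ (-(2 * ε))⌋₊, ∑ T ∈ S, volume (T.set δ ∩ Y k) :=
        Finset.sum_comm
    _ ≤ ∑ _k ∈ Finset.range ⌊δ ^ (-(2 * ε))⌋₊, ENNReal.ofReal B :=
        Finset.sum_le_sum fun k _ => hYsum k
    _ = ENNReal.ofReal (⌊δ ^ (-(2 * ε))⌋₊ * B) := by
        rw [Finset.sum_const, Finset.card_range, nsmul_eq_mul,
          ENNReal.ofReal_mul (Nat.cast_nonneg _), ENNReal.ofReal_natCast]
    _ ≤ ENNReal.ofReal (A₁ * δ ^ (1 / 6 * √ε) * (A⁻¹ * δ ^ (C * ε))) := by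
        refine ENNReal.ofReal_le_ofReal (le_trans ?_ hpow)
        gcongr
        exact Nat.floor_le (by positivity)
    _ = ENNReal.ofReal (A₁ * δ ^ (1 / 6 * √ε)) * ENNReal.ofReal (A⁻¹ * δ ^ (C * ε)) :=
        ENNReal.ofReal_mul (by positivity)
    _ ≤ _ := by gcongr

end
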